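/- Let u_p be a least energy solution of the Finsler Lane-Emden problem -Q_N u = u^p in Ω, u > 0 in Ω, u = 0 on ∂Ω. Then there exist constants 0 < C₁ ≤ C₂ < ∞, independent of p, such that C₁ ≤ ‖u_p‖_{L^∞(Ω)} ≤ C₂ for all sufficiently large p. -/

import Mathlib

open MeasureTheory Filter Real Set
open scoped RealInnerProductSpace Topology NNReal

noncomputable section

abbrev Euc (N : ℕ) := EuclideanSpace ℝ (Fin N)

/-- `H` is a norm on `ℝ^N`: convex, nonnegative, vanishing exactly at `0`,
and absolutely homogeneous. -/
def IsFinslerNorm (N : ℕ) (H : Euc N → ℝ) : Prop :=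
  ConvexOn ℝ Set.univ H ∧
  (∀ ξ, 0 ≤ H ξ) ∧
  (∀ ξ, H ξ = 0 ↔ ξ = 0) ∧
  (∀ (t : ℝ) (ξ : Euc N), H (t • ξ) = |t| * H ξ)

/-- Regularity assumptions: `H ∈ C²(ℝ^N \ {0})`, `H^N ∈ C¹(ℝ^N)`, and the Hessian of
`H^N` is positive definite away from the origin. -/
def FinslerRegular (N : ℕ) (H : Euc N → ℝ) : Prop :=
  ContDiffOn ℝ 2 H {(0 : Euc N)}ᶜ ∧
  ContDiff ℝ 1 (fun ξ => H ξ ^ N) ∧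
  ∀ ξ : Euc N, ξ ≠ 0 → ∀ v : Euc N, v ≠ 0 →
    0 < iteratedFDeriv ℝ 2 (fun ξ => H ξ ^ N) ξ ![v, v]

/-- The dual norm `H⁰(x) = sup_{ξ ≠ 0} ⟪x, ξ⟫ / H(ξ)`. -/
def dualNorm {N : ℕ} (H : Euc N → ℝ) (x : Euc N) : ℝ :=
  sSup {r : ℝ | ∃ ξ : Euc N, ξ ≠ 0 ∧ r = ⟪x, ξ⟫ / H ξ}

/-- `κ_N`, the volume of the Wulff ball `{H⁰ < 1}`. -/
def wulffVol (N : ℕ) (H : Euc N → ℝ) : ℝ :=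
  (volume {x : Euc N | dualNorm H x < 1}).toReal

/-- `β_N = N (N κ_N)^{1/(N-1)}`. -/
def betaN (N : ℕ) (H : Euc N → ℝ) : ℝ :=
  N * (N * wulffVol N H) ^ ((1 : ℝ) / ((N : ℝ) - 1))

/-- `u` is a weak solution of `-Q_N u = g` on the open set `U`:
`∫_U H(∇u)^{N-1} ⟪∇H(∇u), ∇φ⟫ = ∫_U g φ` for all test functions `φ`. -/
def IsWeakSolution (N : ℕ) (H : Euc N → ℝ) (U : Set (Euc N)) (u g : Euc N → ℝ) : Prop :=
  ∀ φ : Euc N → ℝ, ContDiff ℝ (⊤ : ℕ∞) φ → HasCompactSupport φ → tsupport φ ⊆ U →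
    (∫ x in U, H (gradient u x) ^ (N - 1) * ⟪gradient H (gradient u x), gradient φ x⟫)
      = ∫ x in U, g x * φ x

/-- `C_p`, the infimum of `∫_Ω H(∇u)^N` over test functions normalized in `L^{p+1}`. -/
def energyInf (N : ℕ) (H : Euc N → ℝ) (Ω : Set (Euc N)) (p : ℝ) : ℝ :=
  sInf {c : ℝ | ∃ u : Euc N → ℝ, ContDiff ℝ (⊤ : ℕ∞) u ∧ HasCompactSupport u ∧
    tsupport u ⊆ Ω ∧ (∫ x in Ω, |u x| ^ (p + 1)) = 1 ∧
    c = ∫ x in Ω, H (gradient u x) ^ N}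

/-- A least energy solution of the Finsler Lane–Emden problem on `Ω` with exponent `p`. -/
def IsLeastEnergySolution (N : ℕ) (H : Euc N → ℝ) (Ω : Set (Euc N)) (p : ℝ)
    (u : Euc N → ℝ) : Prop :=
  ContDiffOn ℝ 1 u (closure Ω) ∧
  (∀ x ∈ Ω, 0 < u x) ∧
  (∀ x ∈ frontier Ω, u x = 0) ∧
  IsWeakSolution N H Ω u (fun x => u x ^ p) ∧
  (∫ x in Ω, H (gradient u x) ^ N)
    = energyInf N H Ω p * (∫ x in Ω, u x ^ (p + 1)) ^ ((N : ℝ) / (p + 1))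

/-- The blow-up set of a sequence of functions `v n` on `Ω`. -/
def BlowUpSet {N : ℕ} (Ω : Set (Euc N)) (v : ℕ → Euc N → ℝ) : Set (Euc N) :=
  {x | x ∈ closure Ω ∧ ∃ σ : ℕ → ℕ, StrictMono σ ∧ ∃ xs : ℕ → Euc N,
    (∀ n, xs n ∈ Ω) ∧ Tendsto xs atTop (𝓝 x) ∧
    Tendsto (fun n => v (σ n) (xs n)) atTop atTop}

/-- The gradient of `H^N` expressed through the gradient of `H`, valid also at the origin. -/
lemma IsFinslerNorm.pow_mul_inner_gradient {N : ℕ} (hN : 2 ≤ N) {H : Euc N → ℝ}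
    (hnorm : IsFinslerNorm N H) (hreg : FinslerRegular N H) (ξ v : Euc N) :
    H ξ ^ (N - 1) * ⟪gradient H ξ, v⟫ = (1 / N : ℝ) * ⟪gradient (fun η => H η ^ N) ξ, v⟫ := by
  obtain ⟨-, hpos, hzero, -⟩ := hnorm
  obtain ⟨hC2, hC1, -⟩ := hreg
  have hN0 : (N : ℝ) ≠ 0 := by positivity
  rw [inner_gradient_left, inner_gradient_left]
  by_cases hξ : ξ = 0
  · subst hξ
    have h0 : H 0 = 0 := (hzero 0).2 rfl
    have hmin : IsLocalMin (fun η => H η ^ N) (0 : Euc N) :=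
      Eventually.of_forall fun η => by
        simpa [h0, show N ≠ 0 by lia] using pow_nonneg (hpos η) N
    rw [hmin.fderiv_eq_zero, h0, zero_pow (by lia)]
    simp
  · have hd : DifferentiableAt ℝ H ξ :=
      (hC2.contDiffAt (isOpen_compl_singleton.mem_nhds hξ)).differentiableAt (by norm_num)
    rw [(hd.hasFDerivAt.pow N).fderiv]
    simp
    field_simp

/-- Euler's identity for `H^N`. -/
lemma IsFinslerNorm.inner_gradient_pow_self {N : ℕ} {H : Euc N → ℝ}
    (hnorm : IsFinslerNorm N H) (hreg : FinslerRegular N H) (ξ : Euc N) :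
    ⟪gradient (fun η => H η ^ N) ξ, ξ⟫ = N * H ξ ^ N := by
  obtain ⟨-, -, -, hhom⟩ := hnorm
  rw [inner_gradient_left]
  have hd : DifferentiableAt ℝ (fun η => H η ^ N) ((1 : ℝ) • ξ) :=
    (hreg.2.1.differentiable one_ne_zero) _
  have h1 : HasDerivAt (fun t : ℝ => t • ξ) ξ 1 := by
    simpa using (hasDerivAt_id (1 : ℝ)).smul_const ξ
  have h2 := hd.hasFDerivAt.comp_hasDerivAt (1 : ℝ) h1
  have h3 : HasDerivAt (fun t : ℝ => t ^ N * H ξ ^ N) (N * H ξ ^ N) 1 := by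
    simpa using (hasDerivAt_pow N (1 : ℝ)).mul_const (H ξ ^ N)
  have h4 : ((fun η => H η ^ N) ∘ fun t : ℝ => t • ξ) =ᶠ[𝓝 1] fun t : ℝ => t ^ N * H ξ ^ N := by
    filter_upwards [lt_mem_nhds (zero_lt_one' ℝ)] with t ht
    simp [hhom, mul_pow, abs_of_pos ht]
  have := h2.unique (h3.congr_of_eventuallyEq h4)
  simpa using this

/-- `H^N` controls the `N`-th power of the Euclidean norm. -/
lemma IsFinslerNorm.exists_le_pow {N : ℕ} (hN : 2 ≤ N) {H : Euc N → ℝ}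
    (hnorm : IsFinslerNorm N H) (hreg : FinslerRegular N H) :
    ∃ c : ℝ, 0 < c ∧ ∀ ξ, c * ‖ξ‖ ^ N ≤ H ξ ^ N := by
  obtain ⟨-, hpos, hzero, hhom⟩ := hnorm
  have : Nontrivial (Fin N) := Fin.nontrivial_iff_two_le.2 hN
  have : Nontrivial (Euc N) := inferInstance
  obtain ⟨ζ, hζ, hmin⟩ := (isCompact_sphere (0 : Euc N) 1).exists_isMinOn
    (NormedSpace.sphere_nonempty.2 zero_le_one) hreg.2.1.continuous.continuousOn
  have hζ0 : ζ ≠ 0 := by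
    rintro rfl
    simp at hζ
  refine ⟨H ζ ^ N, pow_pos ((hpos ζ).lt_of_ne fun h => hζ0 ((hzero ζ).1 h.symm)) N, fun ξ => ?_⟩
  by_cases hξ : ξ = 0
  · subst hξ
    simpa [show N ≠ 0 by lia] using pow_nonneg (hpos 0) N
  have hn : 0 < ‖ξ‖ := norm_pos_iff.2 hξ
  have h1 : H ζ ^ N ≤ H (‖ξ‖⁻¹ • ξ) ^ N :=
    hmin (by simp [norm_smul, hn.ne'] : ‖ξ‖⁻¹ • ξ ∈ Metric.sphere (0 : Euc N) 1)
  rw [hhom, abs_of_pos (inv_pos.2 hn), mul_pow, inv_pow, inv_mul_eq_div,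
    le_div_iff₀ (by positivity)] at h1
  exact h1

/-- `C¹` compactly supported functions are `C¹`-limits of test functions supported in a fixed
compact set. -/
lemma exists_smooth_approx {N : ℕ} {g : Euc N → ℝ} (hg : ContDiff ℝ 1 g)
    (hgc : HasCompactSupport g) {U : Set (Euc N)} (hU : IsOpen U) (hgU : tsupport g ⊆ U) :
    ∃ K : Set (Euc N), IsCompact K ∧ K ⊆ U ∧ tsupport g ⊆ K ∧ ∀ ε > 0, ∃ φ : Euc N → ℝ,
      ContDiff ℝ (⊤ : ℕ∞) φ ∧ HasCompactSupport φ ∧ tsupport φ ⊆ K ∧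
      ∀ x, |φ x - g x| ≤ ε ∧ ‖fderiv ℝ φ x - fderiv ℝ g x‖ ≤ ε := by
  obtain ⟨δ, hδ, hδU⟩ := hgc.isCompact.exists_cthickening_subset_open hU hgU
  have hKc : IsCompact (Metric.cthickening δ (tsupport g)) := hgc.isCompact.cthickening
  refine ⟨Metric.cthickening δ (tsupport g), hKc, hδU, Metric.self_subset_cthickening _,
    fun ε hε => ?_⟩
  have hg' : Continuous (fderiv ℝ g) := hg.continuous_fderiv one_ne_zero
  obtain ⟨δ₁, hδ₁, h₁⟩ := Metric.uniformContinuous_iff.1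
    (hgc.uniformContinuous_of_continuous hg.continuous) ε hε
  obtain ⟨δ₂, hδ₂, h₂⟩ := Metric.uniformContinuous_iff.1
    ((hgc.fderiv ℝ).uniformContinuous_of_continuous hg') ε hε
  set r := min δ (min δ₁ δ₂) with hr
  have hr0 : 0 < r := by positivity
  let b : ContDiffBump (0 : Euc N) := ⟨r / 2, r, by positivity, by linarith⟩
  have hbl : LocallyIntegrable (b.normed volume) volume :=
    b.continuous_normed.locallyIntegrable
  let φ := convolution (b.normed volume) g (ContinuousLinearMap.lsmul ℝ ℝ) volume
  have hderiv : ∀ x, fderiv ℝ φ x =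
      convolution (b.normed volume) (fderiv ℝ g) (ContinuousLinearMap.lsmul ℝ ℝ) volume x := by
    intro x
    rw [(hgc.hasFDerivAt_convolution_right (ContinuousLinearMap.lsmul ℝ ℝ) hbl hg x).fderiv]
    rfl
  have hzero : ∀ x ∉ Metric.cthickening δ (tsupport g), φ x = 0 := by
    intro x hx
    have hball : ∀ y ∈ Metric.ball x r, g y = 0 := by
      intro y hy
      by_contra hy0
      refine hx (Metric.mem_cthickening_of_dist_le x y δ _ (subset_tsupport _ hy0) ?_)
      rw [dist_comm]
      exact (Metric.mem_ball.1 hy).le.trans (min_le_left _ _)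
    have := b.normed_convolution_eq_right (μ := volume) (g := g) (x₀ := x) fun y hy => by
      rw [hball y hy, hball x (Metric.mem_ball_self hr0)]
    rw [show φ x = g x from this, hball x (Metric.mem_ball_self hr0)]
  have hsupp : tsupport φ ⊆ Metric.cthickening δ (tsupport g) :=
    closure_minimal (Function.support_subset_iff'.2 hzero) hKc.isClosed
  refine ⟨φ, ?_, HasCompactSupport.intro hKc hzero, hsupp, fun x => ⟨?_, ?_⟩⟩
  · exact b.hasCompactSupport_normed.contDiff_convolution_left (ContinuousLinearMap.lsmul ℝ ℝ)
      b.contDiff_normed (hg.continuous.locallyIntegrable)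
  · rw [← Real.dist_eq]
    refine b.dist_normed_convolution_le hg.continuous.aestronglyMeasurable fun y hy => ?_
    exact (h₁ ((Metric.mem_ball.1 hy).trans_le ((min_le_right _ _).trans (min_le_left _ _)))).le
  · rw [← dist_eq_norm, hderiv]
    refine b.dist_normed_convolution_le hg'.aestronglyMeasurable fun y hy => ?_
    exact (h₂ ((Metric.mem_ball.1 hy).trans_le ((min_le_right _ _).trans (min_le_right _ _)))).le

/-- A weak divergence identity with continuous coefficients extends from smooth to `C¹` test
functions. -/
lemma weak_identity_of_contDiff_one {N : ℕ} {U : Set (Euc N)} (hU : IsOpen U)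
    {A : Euc N → Euc N} {b : Euc N → ℝ} (hA : ContinuousOn A U) (hb : ContinuousOn b U)
    (h : ∀ φ : Euc N → ℝ, ContDiff ℝ (⊤ : ℕ∞) φ → HasCompactSupport φ → tsupport φ ⊆ U →
      ∫ x in U, ⟪A x, gradient φ x⟫ = ∫ x in U, b x * φ x)
    {g : Euc N → ℝ} (hg : ContDiff ℝ 1 g) (hgc : HasCompactSupport g) (hgU : tsupport g ⊆ U) :
    ∫ x in U, ⟪A x, gradient g x⟫ = ∫ x in U, b x * g x := by
  obtain ⟨K, hK, hKU, hgK, happ⟩ := exists_smooth_approx hg hgc hU hgU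
  have hAK := hA.mono hKU
  have hbK := hb.mono hKU
  have hiA : IntegrableOn (fun x => ‖A x‖) K := hAK.norm.integrableOn_compact hK
  have hib : IntegrableOn (fun x => ‖b x‖) K := hbK.norm.integrableOn_compact hK
  have hA' : ∀ ψ : Euc N → ℝ, ContDiff ℝ 1 ψ → tsupport ψ ⊆ K →
      ∫ x in U, ⟪A x, gradient ψ x⟫ = ∫ x in K, fderiv ℝ ψ x (A x) := by
    intro ψ _ hψK
    have hswap : ∀ x, ⟪A x, gradient ψ x⟫ = fderiv ℝ ψ x (A x) := fun x => by
      rw [real_inner_comm, inner_gradient_left]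
    simp_rw [hswap]
    refine (setIntegral_eq_of_subset_of_forall_sdiff_eq_zero hU.measurableSet hKU
      fun x hx => ?_)
    rw [image_eq_zero_of_notMem_tsupport fun h => hx.2 (hψK (tsupport_fderiv_subset ℝ h))]
    simp
  have hb' : ∀ ψ : Euc N → ℝ, tsupport ψ ⊆ K →
      ∫ x in U, b x * ψ x = ∫ x in K, b x * ψ x := by
    intro ψ hψK
    refine (setIntegral_eq_of_subset_of_forall_sdiff_eq_zero hU.measurableSet hKU
      fun x hx => ?_)
    rw [image_eq_zero_of_notMem_tsupport fun h => hx.2 (hψK h), mul_zero]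
  have hintA : ∀ ψ : Euc N → ℝ, ContDiff ℝ 1 ψ →
      IntegrableOn (fun x => fderiv ℝ ψ x (A x)) K := fun ψ hψ =>
    ((hψ.continuous_fderiv one_ne_zero).continuousOn.clm_apply hAK).integrableOn_compact hK
  have hintb : ∀ ψ : Euc N → ℝ, ContDiff ℝ 1 ψ → IntegrableOn (fun x => b x * ψ x) K :=
    fun ψ hψ => (hbK.mul hψ.continuous.continuousOn).integrableOn_compact hK
  rw [hA' g hg hgK, hb' g hgK, ← sub_eq_zero, ← abs_nonpos_iff]
  refine le_of_forall_pos_le_add fun η hη => ?_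
  set M := (∫ x in K, ‖A x‖) + ∫ x in K, ‖b x‖ with hM
  have hM0 : 0 ≤ M := by positivity
  obtain ⟨φ, hφ, hφc, hφK, hφg⟩ := happ (η / (M + 1)) (by positivity)
  have hφ1 : ContDiff ℝ 1 φ := hφ.of_le (by exact_mod_cast le_top)
  have hw := h φ hφ hφc (hφK.trans hKU)
  rw [hA' φ hφ1 hφK, hb' φ hφK] at hw
  have e1 : |(∫ x in K, fderiv ℝ g x (A x)) - ∫ x in K, fderiv ℝ φ x (A x)| ≤
      η / (M + 1) * ∫ x in K, ‖A x‖ := by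
    rw [← integral_sub (hintA g hg) (hintA φ hφ1), ← integral_const_mul, ← Real.norm_eq_abs]
    refine norm_integral_le_of_norm_le (hiA.const_mul _) (Eventually.of_forall fun x => ?_)
    rw [← sub_apply]
    refine (ContinuousLinearMap.le_opNorm _ _).trans ?_
    rw [norm_sub_rev]
    exact mul_le_mul_of_nonneg_right (hφg x).2 (norm_nonneg _)
  have e2 : |(∫ x in K, b x * φ x) - ∫ x in K, b x * g x| ≤
      η / (M + 1) * ∫ x in K, ‖b x‖ := by
    rw [← integral_sub (hintb φ hφ1) (hintb g hg), ← integral_const_mul, ← Real.norm_eq_abs]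
    refine norm_integral_le_of_norm_le (hib.const_mul _) (Eventually.of_forall fun x => ?_)
    rw [← mul_sub, norm_mul, mul_comm, Real.norm_eq_abs (φ x - g x)]
    exact mul_le_mul_of_nonneg_right (hφg x).1 (norm_nonneg _)
  have e3 : η / (M + 1) * M ≤ η := by
    rw [div_mul_eq_mul_div, div_le_iff₀ (by positivity)]
    nlinarith
  calc _ ≤ |(∫ x in K, fderiv ℝ g x (A x)) - ∫ x in K, fderiv ℝ φ x (A x)| +
        |(∫ x in K, b x * φ x) - ∫ x in K, b x * g x| := by
        rw [hw]; exact (abs_sub_le _ _ _)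
    _ ≤ η / (M + 1) * M := by rw [hM, mul_add]; exact add_le_add e1 e2
    _ ≤ 0 + η := by linarith

/-- A scale-invariant Sobolev inequality: the `L¹` norm of a nonnegative `C¹` compactly supported
function is controlled by the measure of a set carrying it and the `L^N` norm of its derivative. -/
lemma exists_sobolev_const {N : ℕ} (hN : 2 ≤ N) :
    ∃ C : ℝ, 0 ≤ C ∧ ∀ (f : Euc N → ℝ) (A : Set (Euc N)), ContDiff ℝ 1 f → HasCompactSupport f →
      (∀ x, 0 ≤ f x) → MeasurableSet A → volume A ≠ ⊤ → (∀ x ∉ A, f x = 0) →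
      (∫ x, f x) ^ N ≤ C * volume.real A ^ N * ∫ x, ‖fderiv ℝ f x‖ ^ N := by
  have hN1 : (1 : ℝ≥0) < N := by exact_mod_cast (by lia : 1 < N)
  have hconj := NNReal.HolderConjugate.conjExponent hN1
  set q := NNReal.conjExponent (N : ℝ≥0)
  have hq : NNReal.HolderConjugate (Module.finrank ℝ (Euc N)) q := by simpa using hconj
  have hq1 : (1 : ENNReal) ≤ q := by exact_mod_cast hconj.symm.lt.le
  have hN1' : (1 : ENNReal) ≤ N := by exact_mod_cast (by lia : 1 ≤ N)
  set C : ℝ≥0 := eLpNormLESNormFDerivOneConst (volume : Measure (Euc N)) q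
  refine ⟨(C : ℝ) ^ N, by positivity, fun f A hf hfc hf0 hA hAfin hfA => ?_⟩
  have hf' : Continuous (fderiv ℝ f) := hf.continuous_fderiv one_ne_zero
  have hfA' : Function.support (fun x => ‖fderiv ℝ f x‖) ⊆ A :=
    Function.support_subset_iff'.2 fun x hx => by
      rw [norm_eq_zero]
      refine IsLocalMin.fderiv_eq_zero (Eventually.of_forall fun y => ?_)
      simpa [hfA x hx] using hf0 y
  have hfA'' : Function.support f ⊆ A := Function.support_subset_iff'.2 hfA
  have h1 : eLpNorm f 1 volume ≤ eLpNorm f q volume * volume A ^ ((1 : ℝ) - 1 / q) := by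
    rw [← eLpNorm_restrict_eq_of_support_subset hfA'',
      ← eLpNorm_restrict_eq_of_support_subset (p := (q : ENNReal)) hfA'']
    simpa using eLpNorm_le_eLpNorm_mul_rpow_measure_univ (μ := volume.restrict A) hq1
      hf.continuous.aestronglyMeasurable
  have h2 : eLpNorm f q volume ≤ C * eLpNorm (fderiv ℝ f) 1 volume :=
    eLpNorm_le_eLpNorm_fderiv_one volume hf hfc hq
  have h3 : eLpNorm (fderiv ℝ f) 1 volume ≤
      eLpNorm (fderiv ℝ f) N volume * volume A ^ ((1 : ℝ) - 1 / N) := by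
    rw [← eLpNorm_norm (fderiv ℝ f), ← eLpNorm_norm (fderiv ℝ f),
      ← eLpNorm_restrict_eq_of_support_subset hfA',
      ← eLpNorm_restrict_eq_of_support_subset (p := (N : ENNReal)) hfA']
    simpa using eLpNorm_le_eLpNorm_mul_rpow_measure_univ (μ := volume.restrict A) hN1'
      hf'.norm.aestronglyMeasurable
  have hexp : ((1 : ℝ) - 1 / N) + (1 - 1 / q) = 1 := by
    have := hconj.coe.inv_add_inv_eq_one
    push_cast at this
    simp only [one_div]
    linarith
  have hN0 : (0 : ℝ) ≤ 1 - 1 / N := by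
    rw [sub_nonneg, div_le_one (by positivity)]
    exact_mod_cast (by lia : 1 ≤ N)
  have hq0 : (0 : ℝ) ≤ 1 - 1 / q := by
    have : (1 : ℝ) ≤ q := by exact_mod_cast hconj.symm.lt.le
    rw [sub_nonneg, div_le_one (by linarith)]
    exact this
  have h4 : eLpNorm f 1 volume ≤ C * volume A * eLpNorm (fderiv ℝ f) N volume := by
    calc eLpNorm f 1 volume ≤ (C * (eLpNorm (fderiv ℝ f) N volume *
          volume A ^ ((1 : ℝ) - 1 / N))) * volume A ^ ((1 : ℝ) - 1 / q) := by
          refine h1.trans ?_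
          gcongr
          refine h2.trans ?_
          gcongr
      _ = C * (volume A ^ ((1 : ℝ) - 1 / N) * volume A ^ ((1 : ℝ) - 1 / q)) *
          eLpNorm (fderiv ℝ f) N volume := by ring
      _ = _ := by rw [← ENNReal.rpow_add_of_nonneg _ _ hN0 hq0, hexp, ENNReal.rpow_one]
  have hm : MemLp (fderiv ℝ f) N volume := hf'.memLp_of_hasCompactSupport (hfc.fderiv ℝ)
  have hm1 : MemLp f 1 volume := hf.continuous.memLp_of_hasCompactSupport hfc
  rw [hm.eLpNorm_eq_integral_rpow_norm (by positivity) (by simp),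
    hm1.eLpNorm_eq_integral_rpow_norm (by simp) (by simp)] at h4
  simp only [ENNReal.toReal_one, Real.rpow_one, inv_one, ENNReal.toReal_natCast,
    Real.rpow_natCast] at h4
  have h5 : (∫ x, ‖f x‖) ≤ C * volume.real A * (∫ x, ‖fderiv ℝ f x‖ ^ N) ^ ((N : ℝ)⁻¹) := by
    rw [← ENNReal.ofReal_toReal hAfin, ← ENNReal.ofReal_coe_nnreal,
      ← ENNReal.ofReal_mul (by positivity), ← ENNReal.ofReal_mul (by positivity)] at h4
    exact (ENNReal.ofReal_le_ofReal_iff (by positivity)).1 h4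
  have h6 : (∫ x, ‖f x‖) = ∫ x, f x :=
    integral_congr_ae (Eventually.of_forall fun x => Real.norm_of_nonneg (hf0 x))
  rw [h6] at h5
  calc (∫ x, f x) ^ N ≤
      (C * volume.real A * (∫ x, ‖fderiv ℝ f x‖ ^ N) ^ ((N : ℝ)⁻¹)) ^ N :=
        pow_le_pow_left₀ (integral_nonneg hf0) h5 N
    _ = _ := by
      rw [mul_pow, mul_pow, Real.rpow_inv_natCast_pow (by positivity) (by lia)]

/-- The slope of the truncation: a continuous ramp from `0` at `k` to `1` at `k + δ`. -/
def ramp (k δ s : ℝ) : ℝ := max 0 (min 1 ((s - k) / δ))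

/-- A `C¹` regularization of `t ↦ (t - k)⁺`. -/
def truncation (k δ t : ℝ) : ℝ := ∫ s in (0 : ℝ)..t, ramp k δ s

lemma continuous_ramp (k δ : ℝ) : Continuous (ramp k δ) := by
  unfold ramp
  fun_prop

lemma ramp_nonneg (k δ s : ℝ) : 0 ≤ ramp k δ s := le_max_left _ _

lemma ramp_le_one (k δ s : ℝ) : ramp k δ s ≤ 1 := max_le zero_le_one (min_le_left _ _)

lemma ramp_eq_zero {k δ s : ℝ} (hδ : 0 < δ) (hs : s ≤ k) : ramp k δ s = 0 :=
  max_eq_left ((min_le_right _ _).trans (div_nonpos_of_nonpos_of_nonneg (by linarith) hδ.le))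

lemma ramp_eq_one {k δ s : ℝ} (hδ : 0 < δ) (hs : k + δ ≤ s) : ramp k δ s = 1 := by
  unfold ramp
  rw [min_eq_left ((one_le_div hδ).2 (by linarith)), max_eq_right zero_le_one]

lemma hasDerivAt_truncation (k δ t : ℝ) : HasDerivAt (truncation k δ) (ramp k δ t) t :=
  (continuous_ramp k δ).integral_hasStrictDerivAt 0 t |>.hasDerivAt

lemma deriv_truncation (k δ : ℝ) : deriv (truncation k δ) = ramp k δ :=
  funext fun t => (hasDerivAt_truncation k δ t).deriv

lemma contDiff_truncation (k δ : ℝ) : ContDiff ℝ 1 (truncation k δ) := by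
  rw [contDiff_one_iff_deriv, deriv_truncation]
  exact ⟨fun t => (hasDerivAt_truncation k δ t).differentiableAt, continuous_ramp k δ⟩

lemma truncation_eq_zero {k δ t : ℝ} (hk : 0 ≤ k) (hδ : 0 < δ) (ht : t ≤ k) :
    truncation k δ t = 0 := by
  refine intervalIntegral.integral_zero_ae (Eventually.of_forall fun s hs => ramp_eq_zero hδ ?_)
  exact hs.2.trans (max_le hk ht)

lemma truncation_nonneg {k δ t : ℝ} (hk : 0 ≤ k) (hδ : 0 < δ) : 0 ≤ truncation k δ t := by
  rcases le_total t k with h | h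
  · exact (truncation_eq_zero hk hδ h).ge
  · exact intervalIntegral.integral_nonneg (hk.trans h) fun s _ => ramp_nonneg k δ s

lemma le_truncation {k δ t : ℝ} (hk : 0 ≤ k) (hδ : 0 < δ) : t - k - δ ≤ truncation k δ t := by
  rcases le_total t (k + δ) with h | h
  · exact le_trans (by linarith) (truncation_nonneg hk hδ)
  have hi : ∀ a b : ℝ, IntervalIntegrable (ramp k δ) volume a b :=
    fun a b => (continuous_ramp k δ).intervalIntegrable a b
  have h1 : ∫ s in (k + δ)..t, ramp k δ s = ∫ _ in (k + δ)..t, (1 : ℝ) :=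
    intervalIntegral.integral_congr fun s hs =>
      ramp_eq_one hδ (by rw [uIcc_of_le h] at hs; exact hs.1)
  have h2 : truncation k δ t = truncation k δ (k + δ) + ∫ s in (k + δ)..t, ramp k δ s :=
    (intervalIntegral.integral_add_adjacent_intervals (hi _ _) (hi _ _)).symm
  rw [h2, h1, intervalIntegral.integral_const]
  have := truncation_nonneg (t := k + δ) hk hδ
  simp only [smul_eq_mul]
  linarith

section Domain

variable {N : ℕ} {Ω : Set (Euc N)} {u : Euc N → ℝ}

/-- Composing with a `C¹` function vanishing below a positive level gives an admissible `C¹`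
test function. -/
lemma contDiff_indicator_comp (hΩo : IsOpen Ω) (hΩb : Bornology.IsBounded Ω)
    (hu : ContDiffOn ℝ 1 u (closure Ω)) (hu0 : ∀ x ∈ frontier Ω, u x = 0) {G : ℝ → ℝ} {k : ℝ}
    (hk : 0 < k) (hG : ContDiff ℝ 1 G) (hG0 : ∀ t ≤ k, G t = 0) :
    ContDiff ℝ 1 (Ω.indicator (G ∘ u)) ∧ HasCompactSupport (Ω.indicator (G ∘ u)) ∧
      tsupport (Ω.indicator (G ∘ u)) ⊆ Ω ∧
      ∀ x ∈ Ω, gradient (Ω.indicator (G ∘ u)) x = deriv G (u x) • gradient u x := by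
  have hcl : IsCompact (closure Ω) := hΩb.isCompact_closure
  set K := closure Ω ∩ u ⁻¹' Ici k with hKdef
  have hK : IsCompact K :=
    hcl.of_isClosed_subset (hu.continuousOn.preimage_isClosed_of_isClosed isClosed_closure
      isClosed_Ici) inter_subset_left
  have hKΩ : K ⊆ Ω := by
    rintro x ⟨hx, hxk⟩
    by_contra hxΩ
    have : x ∈ frontier Ω := ⟨hx, by rwa [hΩo.interior_eq]⟩
    rw [mem_preimage, hu0 x this, mem_Ici] at hxk
    linarith
  have hzero : ∀ x ∉ K, Ω.indicator (G ∘ u) x = 0 := by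
    intro x hx
    by_cases hxΩ : x ∈ Ω
    · rw [indicator_of_mem hxΩ]
      refine hG0 _ (le_of_not_ge fun h => hx ⟨subset_closure hxΩ, h⟩)
    · exact indicator_of_notMem hxΩ _
  have hloc : ∀ x ∈ Ω, Ω.indicator (G ∘ u) =ᶠ[𝓝 x] G ∘ u := fun x hx => by
    filter_upwards [hΩo.mem_nhds hx] with y hy using indicator_of_mem hy _
  have hux : ∀ x ∈ Ω, ContDiffAt ℝ 1 u x := fun x hx =>
    (hu.mono subset_closure).contDiffAt (hΩo.mem_nhds hx)
  refine ⟨contDiff_iff_contDiffAt.2 fun x => ?_, HasCompactSupport.intro hK hzero,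
    (closure_minimal (Function.support_subset_iff'.2 hzero) hK.isClosed).trans hKΩ,
    fun x hx => ?_⟩
  · by_cases hx : x ∈ Ω
    · exact (hG.contDiffAt.comp x (hux x hx)).congr_of_eventuallyEq (hloc x hx)
    · have hxK : Kᶜ ∈ 𝓝 x := hK.isClosed.isOpen_compl.mem_nhds fun h => hx (hKΩ h)
      refine (contDiffAt_const (c := (0 : ℝ))).congr_of_eventuallyEq ?_
      filter_upwards [hxK] with y hy using hzero y hy
  · rw [(hloc x hx).gradient_eq]
    have h1 := ((hG.differentiable one_ne_zero) (u x)).hasDerivAt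
    have h2 := ((hux x hx).differentiableAt one_ne_zero).hasFDerivAt
    rw [gradient, (h1.comp_hasFDerivAt x h2).fderiv, map_smul, gradient]

/-- A `C¹` function on the closure of a bounded open set has bounded gradient. -/
lemma exists_norm_gradient_le (hΩo : IsOpen Ω) (hΩb : Bornology.IsBounded Ω)
    (hu : ContDiffOn ℝ 1 u (closure Ω)) : ∃ B : ℝ, ∀ x ∈ Ω, ‖gradient u x‖ ≤ B := by
  have hcl : IsCompact (closure Ω) := hΩb.isCompact_closure
  suffices h : ∃ B : ℝ, ∀ x ∈ closure Ω ∩ Ω, ‖gradient u x‖ ≤ B by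
    obtain ⟨B, hB⟩ := h
    exact ⟨B, fun x hx => hB x ⟨subset_closure hx, hx⟩⟩
  refine hcl.induction_on (p := fun s => ∃ B : ℝ, ∀ x ∈ s ∩ Ω, ‖gradient u x‖ ≤ B)
    ⟨0, by simp⟩ (fun s t hst ⟨B, hB⟩ => ⟨B, fun x hx => hB x ⟨hst hx.1, hx.2⟩⟩) ?_ ?_
  · rintro s t ⟨B, hB⟩ ⟨B', hB'⟩
    refine ⟨max B B', fun x hx => ?_⟩
    rcases hx.1 with h | h
    · exact (hB x ⟨h, hx.2⟩).trans (le_max_left _ _)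
    · exact (hB' x ⟨h, hx.2⟩).trans (le_max_right _ _)
  · intro x hx
    have h1 : ContDiffWithinAt ℝ (0 + 1) u (closure Ω) x := by simpa using hu x hx
    obtain ⟨v, hv, -, -, f', hf', hf'c⟩ :=
      (contDiffWithinAt_succ_iff_hasFDerivWithinAt' (by simp)).1 h1
    rw [insert_eq_of_mem hx] at hv
    have h2 : ∀ᶠ y in 𝓝[closure Ω] x, ‖f' y‖ < ‖f' x‖ + 1 :=
      hf'c.continuousWithinAt.norm.eventually (gt_mem_nhds (lt_add_one _))
    refine ⟨{y | y ∈ v ∧ ‖f' y‖ < ‖f' x‖ + 1}, inter_mem hv h2, ‖f' x‖ + 1, ?_⟩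
    rintro y ⟨⟨hyv, hyB⟩, hyΩ⟩
    have := (hf' y hyv).hasFDerivAt (mem_of_superset (hΩo.mem_nhds hyΩ) subset_closure)
    rw [gradient, this.fderiv, LinearIsometryEquiv.norm_map]
    exact hyB.le

end Domain

/-- A De Giorgi–Stampacchia iteration: superlinear decay of level sets forces a level set to be
null. -/
lemma eq_zero_of_superlinear_decay {A : ℝ → ℝ} (hA : Antitone A) (hA0 : ∀ t, 0 ≤ A t) {m : ℕ}
    (hm : m ≠ 0) {K k d : ℝ} (hK : 0 ≤ K) (hd : 0 < d)
    (hdecay : ∀ s t, k ≤ s → s < t → ((t - s) / 2 * A t) ^ m ≤ K * A s ^ (m + 1))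
    (hsmall : K * A k * (4 * 2 ^ m) ^ m ≤ d ^ m) : A (k + d) = 0 := by
  have hstep : ∀ n : ℕ, A (k + d * (1 - (1 / 2) ^ n)) ≤ A k * ((1 / 2) ^ n) ^ m := by
    intro n
    induction n with
    | zero => simp
    | succ n ih =>
      set s : ℝ := (1 / 2) ^ n with hs
      have hs0 : 0 < s := by positivity
      have hs1 : s ≤ 1 := pow_le_one₀ (by norm_num) (by norm_num)
      have hs' : ((1 : ℝ) / 2) ^ (n + 1) = s / 2 := by rw [pow_succ, hs]; ring
      rw [hs']
      have h1 := hdecay (k + d * (1 - s)) (k + d * (1 - s / 2))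
        (by nlinarith) (by nlinarith)
      rw [show (k + d * (1 - s / 2) - (k + d * (1 - s))) / 2 = d * s / 4 by ring] at h1
      have h2 : (d * s / 4 * A (k + d * (1 - s / 2))) ^ m ≤
          (d * s / 4 * (A k * (s / 2) ^ m)) ^ m := by
        calc _ ≤ K * A (k + d * (1 - s)) ^ (m + 1) := h1
          _ ≤ K * (A k * s ^ m) ^ (m + 1) := by
            gcongr
            exact hA0 _
          _ = K * A k * (4 * 2 ^ m) ^ m * (s / 4 * (A k * (s / 2) ^ m)) ^ m := by
            rw [div_pow s 2]
            have : (4 * 2 ^ m) ^ m * (s / 4 * (A k * (s ^ m / 2 ^ m))) ^ m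
                = (A k * s ^ m) ^ m * s ^ m := by
              rw [← mul_pow, ← mul_pow]
              congr 1
              field_simp
            rw [mul_assoc (K * A k), this]
            ring
          _ ≤ d ^ m * (s / 4 * (A k * (s / 2) ^ m)) ^ m := by
            have := hA0 k
            gcongr
          _ = _ := by rw [← mul_pow]; ring
      have h3 := (pow_le_pow_iff_left₀ (mul_nonneg (by positivity) (hA0 _))
        (mul_nonneg (by positivity) (mul_nonneg (hA0 _) (by positivity))) hm).1 h2
      exact le_of_mul_le_mul_left h3 (by positivity)
  refine le_antisymm ?_ (hA0 _)
  have hlim : Tendsto (fun n : ℕ => A k * (((1 : ℝ) / 2) ^ n) ^ m) atTop (𝓝 0) := by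
    have := ((tendsto_pow_atTop_nhds_zero_of_lt_one (r := (1 : ℝ) / 2) (by norm_num)
      (by norm_num)).pow m).const_mul (A k)
    simpa [hm] using this
  refine ge_of_tendsto' hlim fun n => (hA ?_).trans (hstep n)
  have : (0 : ℝ) < (1 / 2) ^ n := by positivity
  nlinarith

section LeastEnergy

variable {N : ℕ} {H : Euc N → ℝ} {Ω : Set (Euc N)} {p : ℝ} {u : Euc N → ℝ}

lemma integrableOn_comp (hΩb : Bornology.IsBounded Ω) (hu : ContDiffOn ℝ 1 u (closure Ω))
    {Φ : ℝ → ℝ} (hΦ : Continuous Φ) : IntegrableOn (fun x => Φ (u x)) Ω :=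
  ((hΦ.comp_continuousOn hu.continuousOn).integrableOn_compact hΩb.isCompact_closure).mono_set
    subset_closure

lemma continuousOn_gradient (hΩo : IsOpen Ω) (hu : ContDiffOn ℝ 1 u (closure Ω)) :
    ContinuousOn (gradient u) Ω :=
  (InnerProductSpace.toDual ℝ (Euc N)).symm.continuous.comp_continuousOn
    ((hu.mono subset_closure).continuousOn_fderiv_of_isOpen hΩo le_rfl)

lemma integrableOn_finsler_gradient (hreg : FinslerRegular N H) (hΩo : IsOpen Ω)
    (hΩb : Bornology.IsBounded Ω) (hu : ContDiffOn ℝ 1 u (closure Ω)) :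
    IntegrableOn (fun x => H (gradient u x) ^ N) Ω := by
  obtain ⟨B, hB⟩ := exists_norm_gradient_le hΩo hΩb hu
  obtain ⟨D, hD⟩ := (isCompact_closedBall (0 : Euc N) B).exists_bound_of_continuousOn
    hreg.2.1.continuous.continuousOn
  refine IntegrableOn.of_bound hΩb.measure_lt_top
    ((hreg.2.1.continuous.comp_continuousOn
      (continuousOn_gradient hΩo hu)).aestronglyMeasurable hΩo.measurableSet) D ?_
  filter_upwards [ae_restrict_mem hΩo.measurableSet] with x hx
  exact hD _ (by simpa using hB x hx)

/-- Testing the equation with a truncation of the solution. -/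
lemma IsLeastEnergySolution.integral_ramp_mul (hN : 2 ≤ N) (hnorm : IsFinslerNorm N H)
    (hreg : FinslerRegular N H) (hΩo : IsOpen Ω) (hΩb : Bornology.IsBounded Ω) (hp : 0 ≤ p)
    (h : IsLeastEnergySolution N H Ω p u) {k δ : ℝ} (hk : 0 < k) (hδ : 0 < δ) :
    ∫ x in Ω, ramp k δ (u x) * H (gradient u x) ^ N =
      ∫ x in Ω, u x ^ p * truncation k δ (u x) := by
  obtain ⟨hu, -, hu0, hw, -⟩ := h
  obtain ⟨hv, hvc, hvΩ, hvg⟩ := contDiff_indicator_comp hΩo hΩb hu hu0 hk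
    (contDiff_truncation k δ) fun t ht => truncation_eq_zero hk.le hδ ht
  have hF : Continuous (gradient fun η => H η ^ N) :=
    (InnerProductSpace.toDual ℝ (Euc N)).symm.continuous.comp
      (hreg.2.1.continuous_fderiv one_ne_zero)
  have hA : ContinuousOn (fun x => (1 / N : ℝ) • gradient (fun η => H η ^ N) (gradient u x)) Ω :=
    (hF.comp_continuousOn (continuousOn_gradient hΩo hu)).fun_const_smul (1 / N : ℝ)
  have hb : ContinuousOn (fun x => u x ^ p) Ω :=
    (Real.continuous_rpow_const hp).comp_continuousOn (hu.continuousOn.mono subset_closure)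
  have key := weak_identity_of_contDiff_one hΩo hA hb (fun φ hφ hφc hφΩ => by
    rw [← hw φ hφ hφc hφΩ]
    refine integral_congr_ae (Eventually.of_forall fun x => ?_)
    simp only [real_inner_smul_left]
    rw [hnorm.pow_mul_inner_gradient hN hreg]) hv hvc hvΩ
  have hN0 : (N : ℝ) ≠ 0 := by positivity
  refine Eq.trans ?_ (key.trans ?_) <;>
    refine setIntegral_congr_fun hΩo.measurableSet fun x hx => ?_
  · simp only [hvg x hx, real_inner_smul_left, real_inner_smul_right, deriv_truncation,
      hnorm.inner_gradient_pow_self hreg]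
    field_simp
  · simp [indicator_of_mem hx]

lemma IsLeastEnergySolution.integral_rpow_le (hN : 2 ≤ N) (hnorm : IsFinslerNorm N H)
    (hreg : FinslerRegular N H) (hΩo : IsOpen Ω) (hΩb : Bornology.IsBounded Ω) (hp : 0 ≤ p)
    (h : IsLeastEnergySolution N H Ω p u) :
    ∫ x in Ω, u x ^ (p + 1) ≤ ∫ x in Ω, H (gradient u x) ^ N := by
  have hu := h.1
  have hpos := h.2.1
  have hHi := integrableOn_finsler_gradient hreg hΩo hΩb hu
  have hi1 : IntegrableOn (fun x => u x ^ (p + 1)) Ω :=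
    integrableOn_comp hΩb hu (Real.continuous_rpow_const (by linarith))
  have hi2 : IntegrableOn (fun x => u x ^ p) Ω :=
    integrableOn_comp hΩb hu (Real.continuous_rpow_const hp)
  have hmain : ∀ ε > 0, (∫ x in Ω, u x ^ (p + 1)) - 2 * ε * ∫ x in Ω, u x ^ p ≤
      ∫ x in Ω, H (gradient u x) ^ N := by
    intro ε hε
    rw [← integral_const_mul, ← integral_sub hi1 (hi2.const_mul _)]
    have hi3 : IntegrableOn (fun x => u x ^ p * truncation ε ε (u x)) Ω :=
      integrableOn_comp (Φ := fun t => t ^ p * truncation ε ε t) hΩb hu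
        ((Real.continuous_rpow_const hp).mul (contDiff_truncation ε ε).continuous)
    calc _ ≤ ∫ x in Ω, u x ^ p * truncation ε ε (u x) := by
          refine setIntegral_mono_on (hi1.sub (hi2.const_mul _)) hi3 hΩo.measurableSet
            fun x hx => ?_
          have h1 := le_truncation (t := u x) hε.le hε
          have h2 : 0 ≤ u x ^ p := Real.rpow_nonneg (hpos x hx).le _
          rw [Real.rpow_add_one (hpos x hx).ne']
          nlinarith
      _ = ∫ x in Ω, ramp ε ε (u x) * H (gradient u x) ^ N :=
          (h.integral_ramp_mul hN hnorm hreg hΩo hΩb hp hε hε).symm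
      _ ≤ _ := by
          refine integral_mono_of_nonneg (Eventually.of_forall fun x =>
            mul_nonneg (ramp_nonneg _ _ _) (pow_nonneg (hnorm.2.1 _) _)) hHi
            (Eventually.of_forall fun x => ?_)
          exact mul_le_of_le_one_left (pow_nonneg (hnorm.2.1 _) _) (ramp_le_one _ _ _)
  have hlim : Tendsto (fun ε : ℝ => (∫ x in Ω, u x ^ (p + 1)) - 2 * ε * ∫ x in Ω, u x ^ p)
      (𝓝[>] 0) (𝓝 ((∫ x in Ω, u x ^ (p + 1)) - 2 * 0 * ∫ x in Ω, u x ^ p)) :=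
    (Continuous.tendsto (by fun_prop) 0).mono_left nhdsWithin_le_nhds
  rw [mul_zero, zero_mul, sub_zero] at hlim
  exact le_of_tendsto hlim (by filter_upwards [self_mem_nhdsWithin] with ε hε using hmain ε hε)

/-- Decay of the measure of the superlevel sets, with a constant independent of the exponent. -/
lemma exists_level_set_decay (hN : 2 ≤ N) (hnorm : IsFinslerNorm N H)
    (hreg : FinslerRegular N H) (hΩo : IsOpen Ω) (hΩb : Bornology.IsBounded Ω) :
    ∃ C : ℝ, 0 < C ∧ ∀ (p : ℝ) (u : Euc N → ℝ), 0 ≤ p → IsLeastEnergySolution N H Ω p u →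
      ∀ M : ℝ, (∀ x ∈ Ω, u x ≤ M) → ∀ k h : ℝ, 0 < k → k < h →
        ((h - k) / 2 * volume.real (Ω ∩ u ⁻¹' Ioi h)) ^ (N - 1) ≤
          C * M ^ p * volume.real (Ω ∩ u ⁻¹' Ioi k) ^ N := by
  obtain ⟨S, hS, hsob⟩ := exists_sobolev_const hN
  obtain ⟨c, hc, hcH⟩ := hnorm.exists_le_pow hN hreg
  refine ⟨(S + 1) / c, by positivity, fun p u hp h M hM k t hk hkt => ?_⟩
  have hu := h.1
  have hpos := h.2.1
  rcases Ω.eq_empty_or_nonempty with rfl | ⟨x₀, hx₀⟩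
  · simp [show N ≠ 0 by lia, show N - 1 ≠ 0 by lia]
  have hM0 : 0 < M := (hpos x₀ hx₀).trans_le (hM x₀ hx₀)
  set δ := (t - k) / 2 with hδdef
  have hδ : 0 < δ := by simp only [hδdef]; linarith
  set G := truncation k δ with hG
  have hG0 : ∀ s, 0 ≤ G s := fun s => truncation_nonneg hk.le hδ
  have hGc : Continuous G := (contDiff_truncation k δ).continuous
  obtain ⟨hv, hvc, hvΩ, hvg⟩ := contDiff_indicator_comp hΩo hΩb hu h.2.2.1 hk
    (contDiff_truncation k δ) fun t ht => truncation_eq_zero hk.le hδ ht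
  set v := Ω.indicator (G ∘ u) with hvdef
  have hopen : ∀ s, IsOpen (Ω ∩ u ⁻¹' Ioi s) := fun s =>
    (hu.continuousOn.mono subset_closure).isOpen_inter_preimage hΩo isOpen_Ioi
  have hfin : ∀ s, volume (Ω ∩ u ⁻¹' Ioi s) ≠ ⊤ := fun s =>
    (hΩb.subset inter_subset_left).measure_lt_top.ne
  set J := ∫ x in Ω, G (u x) with hJ
  have hGi : IntegrableOn (fun x => G (u x)) Ω := integrableOn_comp hΩb hu hGc
  have hJv : ∫ x, v x = J := integral_indicator hΩo.measurableSet
  have hJ0 : 0 ≤ J := integral_nonneg fun x => hG0 _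
  have hlow : δ * volume.real (Ω ∩ u ⁻¹' Ioi t) ≤ J := by
    calc δ * volume.real (Ω ∩ u ⁻¹' Ioi t) = ∫ _ in Ω ∩ u ⁻¹' Ioi t, δ := by
          rw [setIntegral_const, smul_eq_mul, mul_comm]
      _ ≤ ∫ x in Ω ∩ u ⁻¹' Ioi t, G (u x) := by
          refine setIntegral_mono_on (integrableOn_const (hfin t))
            (hGi.mono_set inter_subset_left) (hopen t).measurableSet fun x hx => ?_
          have h1 : t < u x := hx.2
          have := le_truncation (t := u x) hk.le hδ
          linarith
      _ ≤ J := setIntegral_mono_set hGi (Eventually.of_forall fun x => hG0 _)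
          (Eventually.of_forall inter_subset_left)
  have hgrad : ∫ x, ‖fderiv ℝ v x‖ ^ N ≤ c⁻¹ * (M ^ p * J) := by
    have hHi := integrableOn_finsler_gradient hreg hΩo hΩb hu
    have e1 : ∫ x, ‖fderiv ℝ v x‖ ^ N = ∫ x in Ω, ‖fderiv ℝ v x‖ ^ N := by
      refine (setIntegral_eq_integral_of_forall_compl_eq_zero fun x hx => ?_).symm
      rw [image_eq_zero_of_notMem_tsupport fun h => hx (hvΩ (tsupport_fderiv_subset ℝ h))]
      simp [show N ≠ 0 by lia]
    have hri : IntegrableOn (fun x => ramp k δ (u x) * H (gradient u x) ^ N) Ω := by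
      refine hHi.mono' (((continuous_ramp k δ).comp_continuousOn
        (hu.continuousOn.mono subset_closure)).aestronglyMeasurable hΩo.measurableSet |>.mul
        hHi.aestronglyMeasurable) (Eventually.of_forall fun x => ?_)
      have := pow_nonneg (hnorm.2.1 (gradient u x)) N
      rw [Real.norm_of_nonneg (mul_nonneg (ramp_nonneg _ _ _) this)]
      exact mul_le_of_le_one_left this (ramp_le_one _ _ _)
    have hvi : IntegrableOn (fun x => ‖fderiv ℝ v x‖ ^ N) Ω :=
      (((hv.continuous_fderiv one_ne_zero).norm.pow N).integrable_of_hasCompactSupport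
        ((hvc.fderiv ℝ).comp_left (g := fun y => ‖y‖ ^ N)
          (by simp [show N ≠ 0 by lia]))).integrableOn
    rw [e1]
    calc _ ≤ ∫ x in Ω, c⁻¹ * (ramp k δ (u x) * H (gradient u x) ^ N) := by
          refine setIntegral_mono_on hvi (hri.const_mul _) hΩo.measurableSet fun x hx => ?_
          have e2 : ‖fderiv ℝ v x‖ = ramp k δ (u x) * ‖gradient u x‖ := by
            rw [← toDual_gradient, LinearIsometryEquiv.norm_map, hvg x hx, norm_smul,
              deriv_truncation, Real.norm_of_nonneg (ramp_nonneg _ _ _)]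
          rw [e2, mul_pow, ← mul_assoc, mul_comm c⁻¹, mul_assoc]
          refine mul_le_mul ?_ ?_ (by positivity) (ramp_nonneg _ _ _)
          · exact pow_le_of_le_one (ramp_nonneg _ _ _) (ramp_le_one _ _ _) (by lia)
          · rw [inv_mul_eq_div, le_div_iff₀ hc, mul_comm]
            exact hcH _
      _ = c⁻¹ * ∫ x in Ω, u x ^ p * G (u x) := by
          rw [integral_const_mul, h.integral_ramp_mul hN hnorm hreg hΩo hΩb hp hk hδ]
      _ ≤ c⁻¹ * ∫ x in Ω, M ^ p * G (u x) := by
          refine mul_le_mul_of_nonneg_left (setIntegral_mono_on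
            (integrableOn_comp (Φ := fun t => t ^ p * G t) hΩb hu
              ((Real.continuous_rpow_const hp).mul hGc)) (hGi.const_mul _) hΩo.measurableSet
            fun x hx => ?_) (by positivity)
          exact mul_le_mul_of_nonneg_right
            (Real.rpow_le_rpow (hpos x hx).le (hM x hx) hp) (hG0 _)
      _ = _ := by rw [integral_const_mul]
  have hvpos : ∀ x, 0 ≤ v x := fun x => indicator_nonneg (fun y _ => hG0 (u y)) x
  have hs := hsob v (Ω ∩ u ⁻¹' Ioi k) hv hvc hvpos (hopen k).measurableSet (hfin k)
    fun x hx => by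
      by_cases hxΩ : x ∈ Ω
      · rw [hvdef, indicator_of_mem hxΩ]
        exact truncation_eq_zero hk.le hδ (le_of_not_gt fun h => hx ⟨hxΩ, h⟩)
      · exact indicator_of_notMem hxΩ _
  rw [hJv] at hs
  have hfinal : J ^ (N - 1) ≤ (S + 1) / c * M ^ p * volume.real (Ω ∩ u ⁻¹' Ioi k) ^ N := by
    rcases hJ0.eq_or_lt with h0 | h0
    · rw [← h0, zero_pow (by lia)]
      positivity
    refine le_of_mul_le_mul_right ?_ h0
    rw [pow_sub_one_mul (by lia)]
    calc J ^ N ≤ S * volume.real (Ω ∩ u ⁻¹' Ioi k) ^ N * (c⁻¹ * (M ^ p * J)) :=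
          hs.trans (by gcongr)
      _ ≤ (S + 1) * volume.real (Ω ∩ u ⁻¹' Ioi k) ^ N * (c⁻¹ * (M ^ p * J)) := by
          gcongr
          linarith
      _ = _ := by rw [div_eq_mul_inv]; ring
  exact (pow_le_pow_left₀ (by positivity) hlow _).trans hfinal

/-- The superlevel sets below the maximum of a least energy solution are quantitatively large. -/
lemma exists_lt_level_set (hN : 2 ≤ N) (hnorm : IsFinslerNorm N H)
    (hreg : FinslerRegular N H) (hΩo : IsOpen Ω) (hΩb : Bornology.IsBounded Ω) :
    ∃ C : ℝ, 0 < C ∧ ∀ (p : ℝ) (u : Euc N → ℝ), 0 ≤ p → IsLeastEnergySolution N H Ω p u →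
      ∀ M : ℝ, (∀ x ∈ Ω, u x ≤ M) → ∀ k d : ℝ, 0 < k → 0 < d → (∃ x ∈ Ω, k + d < u x) →
        d ^ (N - 1) < C * M ^ p * volume.real (Ω ∩ u ⁻¹' Ioi k) := by
  obtain ⟨C, hC, hdecay⟩ := exists_level_set_decay hN hnorm hreg hΩo hΩb
  refine ⟨C * (4 * 2 ^ (N - 1)) ^ (N - 1), by positivity,
    fun p u hp h M hM k d hk hd ⟨x, hx, hxu⟩ => ?_⟩
  have hM0 : 0 < M := (h.2.1 x hx).trans_le (hM x hx)
  have hfin : ∀ s, volume (Ω ∩ u ⁻¹' Ioi s) ≠ ⊤ := fun s =>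
    (hΩb.subset inter_subset_left).measure_lt_top.ne
  by_contra! hcon
  have hzero : volume.real (Ω ∩ u ⁻¹' Ioi (k + d)) = 0 :=
    eq_zero_of_superlinear_decay (A := fun s => volume.real (Ω ∩ u ⁻¹' Ioi s))
      (fun s t hst => measureReal_mono
        (inter_subset_inter_right _ (preimage_mono (Ioi_subset_Ioi hst))) (hfin s))
      (fun _ => measureReal_nonneg) (m := N - 1) (by lia) (K := C * M ^ p) (by positivity) hd
      (fun s t hks hst => by
        rw [Nat.sub_add_cancel (by lia : 1 ≤ N)]
        exact hdecay p u hp h M hM s t (hk.trans_le hks) hst)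
      (by refine le_trans (le_of_eq ?_) hcon; ring)
  have hop : IsOpen (Ω ∩ u ⁻¹' Ioi (k + d)) :=
    (h.1.continuousOn.mono subset_closure).isOpen_inter_preimage hΩo isOpen_Ioi
  have := hop.measure_pos volume ⟨x, hx, hxu⟩
  rw [measureReal_eq_zero_iff (hfin _)] at hzero
  exact this.ne' hzero

end LeastEnergy

/-- Any nontrivial test function bounds the infimum `C_p` after normalization. -/
lemma energyInf_le_of_le_integral {N : ℕ} {H : Euc N → ℝ} (hnorm : IsFinslerNorm N H)
    {Ω : Set (Euc N)} {p : ℝ} (hp : 0 ≤ p) {w : Euc N → ℝ} (hw : ContDiff ℝ (⊤ : ℕ∞) w)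
    (hwc : HasCompactSupport w) (hwΩ : tsupport w ⊆ Ω) {q : ℝ} (hq : 0 < q)
    (hL : q ^ (p + 1) ≤ ∫ x in Ω, |w x| ^ (p + 1)) :
    energyInf N H Ω p ≤ (q⁻¹) ^ N * ∫ x in Ω, H (gradient w x) ^ N := by
  obtain ⟨-, hpos, -, hhom⟩ := hnorm
  set L := ∫ x in Ω, |w x| ^ (p + 1) with hLdef
  have hL0 : 0 < L := (Real.rpow_pos_of_pos hq _).trans_le hL
  have hp1 : 0 < p + 1 := by linarith
  set c := L ^ (-(1 / (p + 1))) with hc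
  have hc0 : 0 < c := Real.rpow_pos_of_pos hL0 _
  have hcq : c ≤ q⁻¹ := by
    rw [hc, Real.rpow_neg hL0.le]
    refine inv_anti₀ hq ?_
    rw [one_div, Real.le_rpow_inv_iff_of_pos hq.le hL0.le hp1]
    exact hL
  have hcL : c ^ (p + 1) * L = 1 := by
    rw [hc, ← Real.rpow_mul hL0.le, neg_mul, one_div, inv_mul_cancel₀ hp1.ne', Real.rpow_neg_one,
      inv_mul_cancel₀ hL0.ne']
  have hgrad : ∀ x, gradient (fun y => c * w y) x = c • gradient w x := by
    intro x
    have := (hw.differentiable (by simp)) x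
    rw [gradient, fderiv_const_mul this, map_smul, gradient]
  have hle : energyInf N H Ω p ≤ ∫ x in Ω, H (gradient (fun y => c * w y) x) ^ N := by
    refine csInf_le ⟨0, ?_⟩ ⟨fun y => c * w y, contDiff_const.mul hw, hwc.mul_left,
      (tsupport_mul_subset_right).trans hwΩ, ?_, rfl⟩
    · rintro _ ⟨v, -, -, -, -, rfl⟩
      exact integral_nonneg fun x => pow_nonneg (hpos _) _
    · simp_rw [abs_mul, abs_of_pos hc0, Real.mul_rpow hc0.le (abs_nonneg _)]
      rw [integral_const_mul, hcL]
  refine hle.trans ?_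
  simp_rw [hgrad, hhom, abs_of_pos hc0, mul_pow]
  rw [integral_const_mul]
  exact mul_le_mul_of_nonneg_right (pow_le_pow_left₀ hc0.le hcq N)
    (integral_nonneg fun x => pow_nonneg (hpos _) _)

/-- The gradient of a dilated function. -/
lemma gradient_comp_smul_sub {N : ℕ} {φ : Euc N → ℝ} (hφ : Differentiable ℝ φ) (a : ℝ)
    (x₀ x : Euc N) :
    gradient (fun y => φ (a • (y - x₀))) x = a • gradient φ (a • (x - x₀)) := by
  have h1 : HasFDerivAt (fun y : Euc N => a • (y - x₀)) (a • ContinuousLinearMap.id ℝ (Euc N)) x :=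
    ((hasFDerivAt_id x).sub_const x₀).const_smul a
  have h2 := (hφ (a • (x - x₀))).hasFDerivAt.comp x h1
  rw [gradient, show (fun y => φ (a • (y - x₀))) = φ ∘ fun y => a • (y - x₀) from rfl, h2.fderiv,
    ContinuousLinearMap.comp_smul, ContinuousLinearMap.comp_id, map_smul, gradient]

/-- The Moser-type upper bound `C_p = O(p^{1-N})`. -/
lemma exists_energyInf_le {N : ℕ} (hN : 2 ≤ N) {H : Euc N → ℝ} (hnorm : IsFinslerNorm N H)
    (hreg : FinslerRegular N H) {Ω : Set (Euc N)} (hΩo : IsOpen Ω) (hΩne : Ω.Nonempty) :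
    ∃ C : ℝ, 0 < C ∧ ∀ p : ℝ, 1 ≤ p → energyInf N H Ω p ≤ C / p ^ (N - 1) := by
  obtain ⟨x₀, hx₀⟩ := hΩne
  obtain ⟨r, hr, hrΩ⟩ := Metric.nhds_basis_closedBall.mem_iff.1 (hΩo.mem_nhds hx₀)
  set R := r / 2 with hR
  have hR0 : 0 < R := by positivity
  let φ : ContDiffBump (0 : Euc N) := ⟨R, r, hR0, by rw [hR]; linarith⟩
  have hφ : ContDiff ℝ (⊤ : ℕ∞) φ := φ.contDiff
  have hφd : Differentiable ℝ φ := hφ.differentiable (by simp)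
  have hφgc : Continuous (gradient φ) :=
    (InnerProductSpace.toDual ℝ (Euc N)).symm.continuous.comp (hφ.continuous_fderiv (by simp))
  have hH0 : H 0 = 0 := (hnorm.2.2.1 0).2 rfl
  have hφg : ∀ y, gradient φ y ≠ 0 → R < ‖y‖ ∧ ‖y‖ < r := by
    intro y hy
    by_contra hcon
    refine hy ?_
    rw [gradient, map_eq_zero_iff _ (LinearIsometryEquiv.injective _)]
    by_cases h1 : R < ‖y‖
    · have h2 : φ y = 0 := φ.zero_of_le_dist
        (by simpa using not_lt.1 fun h => hcon ⟨h1, h⟩)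
      refine IsLocalMin.fderiv_eq_zero (Eventually.of_forall fun z => ?_)
      rw [h2]
      exact φ.nonneg
    · have h2 : φ y = 1 := φ.one_of_mem_closedBall (by simpa using h1)
      refine IsLocalMax.fderiv_eq_zero (Eventually.of_forall fun z => ?_)
      rw [h2]
      exact φ.le_one
  set D := ∫ y, H (gradient φ y) ^ N with hD
  have hD0 : 0 ≤ D := integral_nonneg fun y => pow_nonneg (hnorm.2.1 _) _
  have hFc : Continuous fun y => H (gradient φ y) ^ N := hreg.2.1.continuous.comp hφgc
  have hFs : HasCompactSupport fun y => H (gradient φ y) ^ N := by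
    refine HasCompactSupport.intro (isCompact_closedBall (0 : Euc N) r) fun y hy => ?_
    have : gradient φ y = 0 := by
      by_contra h
      exact hy (by simpa using (hφg y h).2.le)
    rw [this, hH0, zero_pow (by lia)]
  have hFi : Integrable fun y => H (gradient φ y) ^ N := hFc.integrable_of_hasCompactSupport hFs
  set κ := volume.real (Metric.ball (0 : Euc N) 1) with hκ
  have hκ0 : 0 < κ := 
    ENNReal.toReal_pos (Metric.measure_ball_pos volume _ one_pos).ne' measure_ball_lt_top.ne
  set m := min 1 (κ * R ^ N) with hm
  have hm0 : 0 < m := by positivity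
  set q := m / 2 ^ N with hq
  have hq0 : 0 < q := by positivity
  have hq1 : q ≤ 1 := div_le_one_of_le₀
    ((min_le_left _ _).trans (one_le_pow₀ (by norm_num))) (by positivity)
  refine ⟨(q⁻¹) ^ N * (D + 1), by positivity, fun p hp => ?_⟩
  set n := ⌈p⌉₊ with hn
  have hpn : p ≤ n := Nat.le_ceil p
  have hnp : (n : ℝ) ≤ p + 1 := (Nat.ceil_lt_add_one (by linarith)).le
  have hn0 : n ≠ 0 := by
    intro h
    rw [h] at hpn
    simp only [Nat.cast_zero] at hpn
    linarith
  have hn0' : (n : ℝ) ≠ 0 := by exact_mod_cast hn0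
  let Φ : ℕ → Euc N → ℝ := fun j x => φ ((2 : ℝ) ^ j • (x - x₀))
  have hΦ : ∀ j, ContDiff ℝ (⊤ : ℕ∞) (Φ j) := fun j =>
    hφ.comp (show ContDiff ℝ (⊤ : ℕ∞) fun x => (2 : ℝ) ^ j • (x - x₀) by fun_prop)
  have hnormj : ∀ (j : ℕ) (x : Euc N), ‖(2 : ℝ) ^ j • (x - x₀)‖ = 2 ^ j * ‖x - x₀‖ := by
    intro j x
    rw [norm_smul, norm_pow, Real.norm_two]
  have hΦ0 : ∀ j, ∀ x ∉ Metric.closedBall x₀ r, Φ j x = 0 := by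
    intro j x hx
    refine φ.zero_of_le_dist ?_
    rw [dist_zero_right, hnormj]
    rw [Metric.mem_closedBall, dist_eq_norm, not_le] at hx
    exact hx.le.trans (le_mul_of_one_le_left (norm_nonneg _) (one_le_pow₀ (by norm_num)))
  set w : Euc N → ℝ := fun x => (n : ℝ)⁻¹ * ∑ j ∈ Finset.range n, Φ j x with hw
  have hwsm : ContDiff ℝ (⊤ : ℕ∞) w := contDiff_const.mul (ContDiff.sum fun j _ => hΦ j)
  have hw0 : ∀ x ∉ Metric.closedBall x₀ r, w x = 0 := fun x hx => by
    simp only [hw]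
    rw [Finset.sum_eq_zero fun j _ => hΦ0 j x hx, mul_zero]
  have hwc : HasCompactSupport w := HasCompactSupport.intro (isCompact_closedBall x₀ r) hw0
  have hwΩ : tsupport w ⊆ Ω :=
    (closure_minimal (Function.support_subset_iff'.2 hw0) Metric.isClosed_closedBall).trans hrΩ
  have hw1 : ∀ x ∈ Metric.ball x₀ (R / 2 ^ n), w x = 1 := by
    intro x hx
    have : ∀ j ∈ Finset.range n, Φ j x = 1 := by
      intro j hj
      refine φ.one_of_mem_closedBall ?_
      rw [mem_closedBall_zero_iff, hnormj]
      rw [Metric.mem_ball, dist_eq_norm, lt_div_iff₀ (by positivity), mul_comm] at hx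
      refine le_trans ?_ hx.le
      gcongr
      · norm_num
      · exact (Finset.mem_range.1 hj).le
    simp only [hw]
    rw [Finset.sum_congr rfl this]
    simp [hn0']
  have hball : Metric.ball x₀ (R / 2 ^ n) ⊆ Ω := by
    refine (Metric.ball_subset_closedBall.trans (Metric.closedBall_subset_closedBall ?_)).trans hrΩ
    calc R / 2 ^ n ≤ R := div_le_self hR0.le (one_le_pow₀ (by norm_num))
      _ ≤ r := by rw [hR]; linarith
  have hwi : IntegrableOn (fun x => |w x| ^ (p + 1)) Ω := by
    have h1 : Continuous fun x => |w x| ^ (p + 1) :=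
      hwsm.continuous.abs.rpow_const fun _ => Or.inr (by linarith)
    exact (h1.integrable_of_hasCompactSupport (hwc.comp_left (g := fun t => |t| ^ (p + 1))
      (by simp [Real.zero_rpow (by linarith : p + 1 ≠ 0)]))).integrableOn
  have hlow : q ^ (p + 1) ≤ ∫ x in Ω, |w x| ^ (p + 1) := by
    calc q ^ (p + 1) ≤ q ^ (n : ℝ) := Real.rpow_le_rpow_of_exponent_ge hq0 hq1 hnp
      _ = m ^ n / (2 ^ n) ^ N := by
        rw [Real.rpow_natCast, hq, div_pow, ← pow_mul, ← pow_mul, mul_comm]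
      _ ≤ m / (2 ^ n) ^ N := by
        gcongr
        exact pow_le_of_le_one hm0.le (min_le_left _ _) hn0
      _ ≤ κ * R ^ N / (2 ^ n) ^ N := by
        gcongr
        exact min_le_right _ _
      _ = volume.real (Metric.ball x₀ (R / 2 ^ n)) := by
        rw [measureReal_def, Measure.addHaar_ball_of_pos _ _ (by positivity), ENNReal.toReal_mul,
          ENNReal.toReal_ofReal (by positivity), finrank_euclideanSpace_fin, ← measureReal_def,
          ← hκ, div_pow R (2 ^ n)]
        ring
      _ = ∫ x in Metric.ball x₀ (R / 2 ^ n), |w x| ^ (p + 1) := by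
        rw [setIntegral_congr_fun (g := fun _ => (1 : ℝ)) measurableSet_ball fun x hx => by
          simp [hw1 x hx]]
        simp
      _ ≤ _ := setIntegral_mono_set hwi
        (Eventually.of_forall fun x => Real.rpow_nonneg (abs_nonneg _) _)
        (Eventually.of_forall hball)
  have hΦg : ∀ j x, gradient (Φ j) x = (2 : ℝ) ^ j • gradient φ ((2 : ℝ) ^ j • (x - x₀)) :=
    fun j x => gradient_comp_smul_sub hφd _ x₀ x
  have hdisj : ∀ i j x, i < j → gradient (Φ i) x ≠ 0 → gradient (Φ j) x = 0 := by
    intro i j x hij hi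
    by_contra hj
    rw [hΦg, ← ne_eq, smul_ne_zero_iff] at hj
    rw [hΦg, smul_ne_zero_iff] at hi
    have h1 := (hφg _ hi.2).1
    have h2 := (hφg _ hj.2).2
    rw [hnormj] at h1 h2
    have h3 : (2 : ℝ) * 2 ^ i ≤ 2 ^ j := by
      rw [← pow_succ']
      exact pow_le_pow_right₀ (by norm_num) hij
    have h4 := norm_nonneg (x - x₀)
    nlinarith
  have hwg : ∀ x, H (gradient w x) ^ N =
      ((n : ℝ)⁻¹) ^ N * ∑ j ∈ Finset.range n, H (gradient (Φ j) x) ^ N := by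
    intro x
    have e1 : gradient w x = (n : ℝ)⁻¹ • ∑ j ∈ Finset.range n, gradient (Φ j) x := by
      have hdj : ∀ j ∈ Finset.range n, DifferentiableAt ℝ (Φ j) x := fun j _ =>
        (hΦ j).differentiable (by simp) x
      rw [gradient, hw, fderiv_const_mul (by fun_prop), fderiv_fun_sum hdj, map_smul, map_sum]
      rfl
    rw [e1, hnorm.2.2.2, abs_of_nonneg (by positivity), mul_pow]
    congr 1
    by_cases hall : ∀ j ∈ Finset.range n, gradient (Φ j) x = 0
    · rw [Finset.sum_eq_zero hall, Finset.sum_eq_zero fun j hj => by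
        rw [hall j hj, hH0, zero_pow (by lia)], hH0, zero_pow (by lia)]
    · push Not at hall
      obtain ⟨i, hi, hix⟩ := hall
      have hoth : ∀ j, j ≠ i → gradient (Φ j) x = 0 := by
        intro j hji
        rcases lt_or_gt_of_ne hji with h | h
        · by_contra hj
          exact hix (hdisj j i x h hj)
        · exact hdisj i j x h hix
      rw [Finset.sum_eq_single_of_mem i hi fun j _ hji => hoth j hji,
        Finset.sum_eq_single_of_mem i hi fun j _ hji => by
          rw [hoth j hji, hH0, zero_pow (by lia)]]
  have hΦF : ∀ j x, H (gradient (Φ j) x) ^ N =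
      ((2 : ℝ) ^ j) ^ N * (fun y => H (gradient φ ((2 : ℝ) ^ j • y)) ^ N) (x - x₀) := by
    intro j x
    rw [hΦg, hnorm.2.2.2, abs_of_pos (by positivity), mul_pow]
  have hΦi : ∀ j, Integrable fun x => H (gradient (Φ j) x) ^ N := by
    intro j
    simp_rw [hΦF]
    exact ((hFi.comp_smul (by positivity : (2 : ℝ) ^ j ≠ 0)).comp_sub_right x₀).const_mul _
  have hΦint : ∀ j, ∫ x, H (gradient (Φ j) x) ^ N = D := by
    intro j
    simp_rw [hΦF]
    rw [integral_const_mul, integral_sub_right_eq_self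
      (fun y => H (gradient φ ((2 : ℝ) ^ j • y)) ^ N),
      Measure.integral_comp_smul volume (fun y => H (gradient φ y) ^ N),
      finrank_euclideanSpace_fin, abs_of_pos (by positivity), smul_eq_mul, ← mul_assoc,
      mul_inv_cancel₀ (by positivity), one_mul]
  have henergy : ∫ x in Ω, H (gradient w x) ^ N ≤ D / (n : ℝ) ^ (N - 1) := by
    have hint : Integrable fun x => H (gradient w x) ^ N := by
      simp_rw [hwg]
      exact (integrable_finsetSum _ fun j _ => hΦi j).const_mul _
    refine (setIntegral_le_integral hint
      (Eventually.of_forall fun x => pow_nonneg (hnorm.2.1 _) _)).trans (le_of_eq ?_)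
    simp_rw [hwg]
    rw [integral_const_mul, integral_finsetSum _ fun j _ => hΦi j,
      Finset.sum_congr rfl fun j _ => hΦint j, Finset.sum_const, Finset.card_range, nsmul_eq_mul]
    obtain ⟨l, rfl⟩ : ∃ l, N = l + 1 := ⟨N - 1, by lia⟩
    simp only [Nat.add_sub_cancel, pow_succ, inv_pow]
    field_simp
  calc energyInf N H Ω p ≤ (q⁻¹) ^ N * ∫ x in Ω, H (gradient w x) ^ N :=
        energyInf_le_of_le_integral hnorm (by linarith) hwsm hwc hwΩ hq0 hlow
    _ ≤ (q⁻¹) ^ N * ((D + 1) / p ^ (N - 1)) := by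
        gcongr
        refine henergy.trans ?_
        gcongr
        linarith
    _ = _ := by ring

/-- Absorbing a small power. -/
lemma le_sq_mul_of_le_mul_rpow {E C b s : ℝ} (hE : 0 < E) (hC : 1 ≤ C) (hb0 : 0 < b) (hb1 : b ≤ 1)
    (hs0 : 0 ≤ s) (hs1 : s ≤ 1 / 2) (h : E ≤ C * b * E ^ s) : E ≤ C ^ 2 * b := by
  by_contra! hcon
  have h1 : E ^ (1 - s) ≤ C * b := by
    rw [Real.rpow_sub hE, Real.rpow_one, div_le_iff₀ (Real.rpow_pos_of_pos hE _)]
    exact h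
  have h2 : (C ^ 2 * b) ^ (1 - s) < E ^ (1 - s) :=
    Real.rpow_lt_rpow (by positivity) hcon (by linarith)
  have h3 : C ≤ (C ^ 2) ^ (1 - s) := by
    rw [← Real.rpow_natCast, ← Real.rpow_mul (by linarith)]
    refine Real.self_le_rpow_of_one_le hC ?_
    push_cast
    linarith
  have h4 : b ≤ b ^ (1 - s) := Real.self_le_rpow_of_le_one hb0.le hb1 (by linarith)
  rw [Real.mul_rpow (by positivity) hb0.le] at h2
  have h5 : C * b ≤ (C ^ 2) ^ (1 - s) * b ^ (1 - s) :=
    mul_le_mul h3 h4 hb0.le (by positivity)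
  linarith

/-- Uniform `L^∞` bounds for least energy solutions (Theorem 1.1, first part). -/
theorem linfty_bound (N : ℕ) (hN : 2 ≤ N) (H : Euc N → ℝ)
    (hnorm : IsFinslerNorm N H) (hreg : FinslerRegular N H)
    (Ω : Set (Euc N)) (hΩo : IsOpen Ω) (hΩb : Bornology.IsBounded Ω) (hΩne : Ω.Nonempty)
    (u : ℝ → Euc N → ℝ) (hu : ∀ p > 1, IsLeastEnergySolution N H Ω p (u p)) :
    ∃ C₁ C₂ : ℝ, 0 < C₁ ∧ C₁ ≤ C₂ ∧ ∃ p₀ : ℝ, ∀ p ≥ p₀,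
      C₁ ≤ sSup (u p '' Ω) ∧ sSup (u p '' Ω) ≤ C₂ := by
  obtain ⟨C, hC, hlevel⟩ := exists_lt_level_set hN hnorm hreg hΩo hΩb
  obtain ⟨B, hB, henergy⟩ := exists_energyInf_le hN hnorm hreg hΩo hΩne
  have hN2 : (2 : ℝ) ≤ N := by exact_mod_cast hN
  set V := volume.real Ω
  have hV : 0 ≤ V := measureReal_nonneg
  set T := 2 * C * (B + 1) ^ 2 * 8 ^ (N - 1) with hT
  have hT0 : 0 < T := by positivity
  have hc1 : 1 / (1 + 4 ^ (N - 1) * C * V) ≤ 1 :=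
    div_le_one_of_le₀ (le_add_of_nonneg_right (by positivity)) (by positivity)
  refine ⟨1 / (1 + 4 ^ (N - 1) * C * V), 1 + T, by positivity, by linarith, 2 * N, fun p hp => ?_⟩
  have hp1 : 1 < p := by linarith
  have h := hu p hp1
  set v := u p
  have hvc := h.1
  have hpos := h.2.1
  have hbdd : BddAbove (v '' Ω) :=
    (hΩb.isCompact_closure.bddAbove_image hvc.continuousOn).mono (image_mono subset_closure)
  set M := sSup (v '' Ω) with hM
  have hvM : ∀ x ∈ Ω, v x ≤ M := fun x hx => le_csSup hbdd (mem_image_of_mem v hx)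
  have hex : ∀ t < M, ∃ x ∈ Ω, t < v x := fun t ht => by
    obtain ⟨_, ⟨x, hx, rfl⟩, htx⟩ := exists_lt_of_lt_csSup (hΩne.image v) ht
    exact ⟨x, hx, htx⟩
  have hM0 : 0 < M := by
    obtain ⟨x, hx⟩ := hΩne
    exact (hpos x hx).trans_le (hvM x hx)
  have hp0 : 0 ≤ p := by linarith
  constructor
  · by_contra! hlt
    have hM1 : M < 1 := hlt.trans_le hc1
    have h1 := hlevel p v hp0 h M hvM (M / 2) (M / 4) (by positivity) (by positivity)
      (hex _ (by linarith))
    have h2 : volume.real (Ω ∩ v ⁻¹' Ioi (M / 2)) ≤ V :=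
      measureReal_mono inter_subset_left hΩb.measure_lt_top.ne
    have h3 : M ^ p ≤ M * M ^ (N - 1) := by
      rw [mul_pow_sub_one (by lia), ← Real.rpow_natCast]
      exact Real.rpow_le_rpow_of_exponent_ge hM0 hM1.le (by linarith)
    have h4 : (M / 4) ^ (N - 1) < C * (M * M ^ (N - 1)) * V := h1.trans_le (by gcongr)
    rw [div_pow, div_lt_iff₀ (by positivity)] at h4
    have h5 : 1 < 4 ^ (N - 1) * C * V * M := by
      have : 0 < M ^ (N - 1) := by positivity
      by_contra! hcon
      nlinarith
    rw [lt_div_iff₀ (by positivity)] at hlt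
    nlinarith
  · set E := ∫ x in Ω, v x ^ (p + 1) with hE
    set k := M * (1 - 1 / (2 * (p + 1))) with hk
    have hfr : 1 / (2 * (p + 1)) ≤ 1 / 2 := by
      gcongr
      linarith
    have hk0 : 0 < k := mul_pos hM0 (by linarith)
    set A := volume.real (Ω ∩ v ⁻¹' Ioi k) with hA
    have hopen : IsOpen (Ω ∩ v ⁻¹' Ioi k) :=
      (hvc.continuousOn.mono subset_closure).isOpen_inter_preimage hΩo isOpen_Ioi
    have hlev := hlevel p v hp0 h M hvM k (M / (4 * (p + 1))) hk0 (by positivity) (hex _ (by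
      have : M / (4 * (p + 1)) < M * (1 / (2 * (p + 1))) := by
        rw [mul_one_div]
        gcongr
        norm_num
      rw [hk]
      linarith))
    rw [← hA] at hlev
    have hEi : IntegrableOn (fun x => v x ^ (p + 1)) Ω :=
      integrableOn_comp hΩb hvc (Real.continuous_rpow_const (by linarith))
    have hElow : M ^ p * M / 2 * A ≤ E := by
      have hkp : M ^ p * M / 2 ≤ k ^ (p + 1) := by
        have hbern := one_add_mul_self_le_rpow_one_add
          (s := -(1 / (2 * (p + 1)))) (by linarith) (by linarith : 1 ≤ p + 1)
        have : (p + 1) * -(1 / (2 * (p + 1))) = -(1 / 2) := by field_simp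
        rw [this] at hbern
        rw [hk, Real.mul_rpow hM0.le (by linarith), Real.rpow_add_one hM0.ne', sub_eq_add_neg]
        have : 0 < M ^ p * M := by positivity
        nlinarith
      calc M ^ p * M / 2 * A ≤ k ^ (p + 1) * A := by gcongr
        _ = ∫ _ in Ω ∩ v ⁻¹' Ioi k, k ^ (p + 1) := by
          rw [setIntegral_const, smul_eq_mul, mul_comm]
        _ ≤ ∫ x in Ω ∩ v ⁻¹' Ioi k, v x ^ (p + 1) := by
          refine setIntegral_mono_on (integrableOn_const
            (hΩb.subset inter_subset_left).measure_lt_top.ne) (hEi.mono_set inter_subset_left)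
            hopen.measurableSet fun x hx => ?_
          exact Real.rpow_le_rpow hk0.le (le_of_lt hx.2) (by linarith)
        _ ≤ E := setIntegral_mono_set hEi
          ((ae_restrict_mem hΩo.measurableSet).mono fun x hx => Real.rpow_nonneg (hpos x hx).le _)
          (Eventually.of_forall inter_subset_left)
    have hA0 : 0 < A := by
      by_contra! hcon
      have : A = 0 := le_antisymm hcon measureReal_nonneg
      rw [this, mul_zero] at hlev
      exact hlev.not_ge (by positivity)
    have hE0 : 0 < E := lt_of_lt_of_le (by positivity) hElow
    have hpN : 1 ≤ p ^ (N - 1) := one_le_pow₀ hp1.le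
    have hEup : E ≤ (B + 1) ^ 2 * (1 / p ^ (N - 1)) := by
      refine le_sq_mul_of_le_mul_rpow (s := N / (p + 1)) hE0 (by linarith) (by positivity)
        (div_le_one_of_le₀ hpN (by positivity)) (by positivity) ?_ ?_
      · rw [div_le_iff₀ (by linarith)]
        linarith
      · refine (h.integral_rpow_le hN hnorm hreg hΩo hΩb hp0).trans ?_
        rw [h.2.2.2.2]
        refine mul_le_mul_of_nonneg_right ((henergy p hp1.le).trans ?_) (by positivity)
        rw [mul_one_div]
        gcongr
        linarith
    have hMN : M ^ N ≤ T := by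
      have e1 : M * (M / (4 * (p + 1))) ^ (N - 1) ≤ 2 * C * E := by
        have := mul_le_mul_of_nonneg_left hlev.le hM0.le
        nlinarith
      have e2 : M * (M / (8 * p)) ^ (N - 1) ≤ 2 * C * E := by
        refine le_trans ?_ e1
        gcongr M * (M / ?_) ^ (N - 1)
        linarith
      have e3 : M * (M / (8 * p)) ^ (N - 1) ≤ 2 * C * ((B + 1) ^ 2 * (1 / p ^ (N - 1))) :=
        e2.trans (by gcongr)
      rw [div_pow, mul_pow, ← mul_div_assoc, mul_pow_sub_one (by lia),
        div_le_iff₀ (by positivity)] at e3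
      refine e3.trans (le_of_eq ?_)
      rw [hT]
      field_simp
    by_contra! hlt
    have : M ≤ M ^ N := le_self_pow₀ (by linarith) (by lia)
    linarith
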